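/- arXiv:1610.03917 — 3 statements merged into one kernel-verified Lean document; each statement's English description precedes it below -/
import Mathlib

section
/- Let λ > 0, let B be an n×n real symmetric positive semidefinite matrix, let b ∈ ℝⁿ, let D be an m×n real matrix, and let c ∈ ℝ. Then u = 0 is a global minimizer of the objective f(u) = (1/2)(uᵀBu − 2bᵀu + c) + λ‖Du‖₁ over ℝⁿ if and only if bᵀu ≤ λ‖Du‖₁ for every u ∈ ℝⁿ (equivalently, sup_{u : Du ≠ 0} bᵀu/‖Du‖₁ ≤ λ and bᵀu ≤ 0 whenever Du = 0). -/
open Matrix BigOperators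

/-- A quadratic `t² q + t d` that is nonnegative for all `t > 0` has nonnegative slope at `0`. -/
theorem nonneg_of_forall_pos_quadratic_nonneg {q d : ℝ}
    (h : ∀ t : ℝ, 0 < t → 0 ≤ t ^ 2 * q + t * d) : 0 ≤ d := by
  by_contra! hd
  have hq : 0 < |q| + 1 := by positivity
  have ht : 0 < -d / (|q| + 1) := div_pos (neg_pos.2 hd) hq
  set t := -d / (|q| + 1) with ht_def
  have hdt : t * (|q| + 1) = -d := div_mul_cancel₀ _ hq.ne'
  have hslope : 0 ≤ t * q + d := nonneg_of_mul_nonneg_right (by linarith [h t ht]) ht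
  have hle : t * q ≤ t * |q| := mul_le_mul_of_nonneg_left (le_abs_self q) ht.le
  linarith

/-- For λ > 0, B symmetric PSD, the TV-regularized objective
`f(u) = (1/2)(uᵀBu − 2bᵀu + c) + λ‖Du‖₁` has `u = 0` as a global minimizer
iff `bᵀu ≤ λ‖Du‖₁` for every `u`. -/
theorem stmt_0 (n m : ℕ) (lam : ℝ) (hlam : 0 < lam)
    (B : Matrix (Fin n) (Fin n) ℝ) (hBsymm : B.IsSymm)
    (hBpsd : ∀ u : Fin n → ℝ, 0 ≤ u ⬝ᵥ B.mulVec u)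
    (b : Fin n → ℝ) (D : Matrix (Fin m) (Fin n) ℝ) (c : ℝ)
    (f : (Fin n → ℝ) → ℝ)
    (hf : ∀ u : Fin n → ℝ,
      f u = (1/2) * (u ⬝ᵥ B.mulVec u - 2 * (b ⬝ᵥ u) + c)
        + lam * (∑ i, |D.mulVec u i|)) :
    (∀ u : Fin n → ℝ, f 0 ≤ f u) ↔
      (∀ u : Fin n → ℝ, b ⬝ᵥ u ≤ lam * (∑ i, |D.mulVec u i|)) := by
  have hf0 : f 0 = 1 / 2 * c := by simp [hf]
  constructor
  · intro h u
    refine sub_nonneg.1 (nonneg_of_forall_pos_quadratic_nonneg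
      (q := 1 / 2 * (u ⬝ᵥ B.mulVec u)) fun t ht => ?_)
    have hmin := h (t • u)
    rw [hf0, hf] at hmin
    simp only [mulVec_smul, smul_dotProduct, dotProduct_smul, smul_eq_mul, Pi.smul_apply,
      abs_mul, abs_of_pos ht, ← Finset.mul_sum] at hmin
    linarith
  · intro h u
    rw [hf0, hf]
    linarith [h u, hBpsd u]
end

section
/- Let b ∈ ℝⁿ, let D be an m×n real matrix, and let λ > 0. Then the inequality bᵀu ≤ λ‖Du‖₁ holds for every u ∈ ℝⁿ if and only if there exists v ∈ ℝᵐ with Dᵀv = b and ‖v‖_∞ ≤ λ, where ‖v‖_∞ = max_i |v_i|. -/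
open Matrix BigOperators

/-- A vector that is bounded by `c * ‖·‖₁` when paired through `D` lies in the image under `Dᵀ`
of the `ℓ^∞` ball of radius `c`. -/
theorem exists_transpose_mulVec_eq_of_dotProduct_le {ι κ : Type*} [Fintype ι] [Fintype κ]
    (b : κ → ℝ) (D : Matrix ι κ ℝ) {c : ℝ} (hc : 0 ≤ c)
    (h : ∀ u : κ → ℝ, b ⬝ᵥ u ≤ c * ∑ i, |D.mulVec u i|) :
    ∃ v : ι → ℝ, Dᵀ.mulVec v = b ∧ ∀ i, |v i| ≤ c := by
  classical
  let B : Set (ι → ℝ) := Set.Icc (fun _ => -c) (fun _ => c)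
  have mem_B (v : ι → ℝ) : v ∈ B ↔ ∀ i, |v i| ≤ c := by
    simp only [B, Set.mem_Icc, Pi.le_def, abs_le, forall_and]
  suffices hb : b ∈ Dᵀ.mulVecLin '' B by
    obtain ⟨v, hv, hvb⟩ := hb
    exact ⟨v, hvb, (mem_B v).1 hv⟩
  by_contra hb
  have hclosed : IsClosed (Dᵀ.mulVecLin '' B) :=
    (isCompact_Icc.image (LinearMap.continuous_of_finiteDimensional _)).isClosed
  obtain ⟨f, r, hf, hr⟩ :=
    geometric_hahn_banach_closed_point ((convex_Icc _ _).linear_image _) hclosed hb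
  obtain ⟨w, hw⟩ := (dotProductEquiv ℝ κ).surjective f.toLinearMap
  have f_eq (x : κ → ℝ) : f x = x ⬝ᵥ w := by
    rw [dotProduct_comm]
    exact (LinearMap.congr_fun hw x).symm
  let v : ι → ℝ := fun i => c * SignType.sign (D.mulVec w i)
  have hv : v ∈ B := (mem_B v).2 fun i => by
    rcases lt_trichotomy (D.mulVec w i) 0 with hi | hi | hi <;>
      simp [v, hi, abs_of_nonneg hc, hc]
  have hfv : f (Dᵀ.mulVecLin v) = c * ∑ i, |D.mulVec w i| := by
    rw [f_eq, mulVecLin_apply, mulVec_transpose, ← dotProduct_mulVec, dotProduct, Finset.mul_sum]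
    refine Finset.sum_congr rfl fun i _ => ?_
    rw [mul_assoc, sign_mul_self]
  have hlt := (hf _ (Set.mem_image_of_mem _ hv)).trans hr
  rw [hfv, f_eq] at hlt
  exact (h w).not_gt hlt

/-- Dual characterization: `bᵀu ≤ λ‖Du‖₁` for all `u` iff there is
`v ∈ ℝᵐ` with `Dᵀv = b` and `‖v‖_∞ ≤ λ` (i.e. `|v_i| ≤ λ` for all `i`). -/
theorem stmt_3 (n m : ℕ) (b : Fin n → ℝ) (D : Matrix (Fin m) (Fin n) ℝ)
    (lam : ℝ) (hlam : 0 < lam) :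
    (∀ u : Fin n → ℝ, b ⬝ᵥ u ≤ lam * (∑ i, |D.mulVec u i|)) ↔
      (∃ v : Fin m → ℝ, Dᵀ.mulVec v = b ∧ ∀ i, |v i| ≤ lam) := by
  refine ⟨exists_transpose_mulVec_eq_of_dotProduct_le b D hlam.le, ?_⟩
  rintro ⟨v, rfl, hv⟩ u
  rw [mulVec_transpose, ← dotProduct_mulVec, dotProduct, Finset.mul_sum]
  refine Finset.sum_le_sum fun i _ => (le_abs_self _).trans ?_
  rw [abs_mul]
  exact mul_le_mul_of_nonneg_right (hv i) (abs_nonneg _)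
end

section
/- Let X be a finite nonempty index set, and let M⁰, M¹ : X → ℝ with M⁰(x) > 0 and M¹(x) > 0 for all x. Let ȳ⁰, ȳ¹, τ : X → ℝ, and define τ̂(x) = ȳ¹(x) − ȳ⁰(x) and the effective weight M_e(x) = M⁰(x)M¹(x)/(M⁰(x) + M¹(x)). Then the function G(y) = (1/2) Σ_{x ∈ X} [ M⁰(x)(ȳ⁰(x) − y(x))² + M¹(x)(ȳ¹(x) − y(x) − τ(x))² ] over y : X → ℝ has a unique global minimizer y*, given pointwise by y*(x) = (M⁰(x)ȳ⁰(x) + M¹(x)(ȳ¹(x) − τ(x)))/(M⁰(x) + M¹(x)), and its minimum value is G(y*) = (1/2) Σ_{x ∈ X} M_e(x)(τ̂(x) − τ(x))². In particular, for any regularizer Ω(τ), minimizing G(y) + λΩ(τ) jointly over (y, τ) is equivalent to minimizing (1/2) Σ_x M_e(x)(τ̂(x) − τ(x))² + λΩ(τ) over τ. -/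
open BigOperators

/-- If `g a` minimizes `f (a, ·)` for every `a`, a joint infimum is an infimum over `a` alone. -/
theorem Real.iInf_prod_eq_of_forall_le {α β : Type*} [Nonempty α] (f : α × β → ℝ) (g : α → β)
    (h : ∀ a b, f (a, g a) ≤ f (a, b)) : ⨅ p, f p = ⨅ a, f (a, g a) := by
  have hne : Nonempty (α × β) := ‹Nonempty α›.map fun a => (a, g a)
  by_cases hb : BddBelow (Set.range fun a => f (a, g a))
  · have hle : ∀ p : α × β, ⨅ a, f (a, g a) ≤ f p := fun p =>
      (ciInf_le hb p.1).trans (h p.1 p.2)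
    have hf : BddBelow (Set.range f) := ⟨_, Set.forall_mem_range.2 hle⟩
    exact le_antisymm (le_ciInf fun a => ciInf_le hf (a, g a)) (le_ciInf hle)
  · have hf : ¬ BddBelow (Set.range f) := fun hf =>
      hb (hf.mono (Set.range_comp_subset_range (fun a => (a, g a)) f))
    rw [Real.iInf_of_not_bddBelow hb, Real.iInf_of_not_bddBelow hf]

/-- Completing the square in a sum of two weighted squares. -/
theorem weighted_sq_add_weighted_sq {m n : ℝ} (h : m + n ≠ 0) (a b y : ℝ) :
    m * (a - y) ^ 2 + n * (b - y) ^ 2 =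
      m * n / (m + n) * (b - a) ^ 2 + (m + n) * (y - (m * a + n * b) / (m + n)) ^ 2 := by
  field_simp
  ring

/-- Profiling out the control-group means: with positive weights
`M⁰, M¹`, the two-group weighted least squares
`G(y) = (1/2) Σ_x [M⁰(x)(ȳ⁰(x) − y(x))² + M¹(x)(ȳ¹(x) − y(x) − τ(x))²]`
has unique minimizer `y*(x) = (M⁰(x)ȳ⁰(x) + M¹(x)(ȳ¹(x) − τ(x)))/(M⁰(x)+M¹(x))`
with minimum value `(1/2) Σ_x M_e(x)(τ̂(x) − τ(x))²`; consequently, for any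
regularizer `Ω`, minimizing `G(y) + λΩ(τ)` jointly over `(y, τ)` is equivalent
to minimizing the reduced objective over `τ`. -/
theorem stmt_7 (X : Type*) [Fintype X] [Nonempty X]
    (M0 M1 : X → ℝ) (hM0 : ∀ x, 0 < M0 x) (hM1 : ∀ x, 0 < M1 x)
    (ybar0 ybar1 : X → ℝ)
    (tauhat : X → ℝ) (htauhat : ∀ x, tauhat x = ybar1 x - ybar0 x)
    (Me : X → ℝ) (hMe : ∀ x, Me x = M0 x * M1 x / (M0 x + M1 x))
    (G : (X → ℝ) → (X → ℝ) → ℝ)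
    (hG : ∀ (tau y : X → ℝ),
      G tau y = (1/2) * ∑ x, (M0 x * (ybar0 x - y x)^2
        + M1 x * (ybar1 x - y x - tau x)^2))
    (ystar : (X → ℝ) → (X → ℝ))
    (hystar : ∀ (tau : X → ℝ) (x : X),
      ystar tau x = (M0 x * ybar0 x + M1 x * (ybar1 x - tau x)) / (M0 x + M1 x)) :
    (∀ (tau y : X → ℝ), y ≠ ystar tau → G tau (ystar tau) < G tau y)
    ∧ (∀ tau : X → ℝ,
        G tau (ystar tau) = (1/2) * ∑ x, Me x * (tauhat x - tau x)^2)
    ∧ (∀ (Ω : (X → ℝ) → ℝ) (lam : ℝ),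
        (⨅ p : (X → ℝ) × (X → ℝ), (G p.1 p.2 + lam * Ω p.1)) =
          ⨅ tau : X → ℝ,
            ((1/2) * (∑ x, Me x * (tauhat x - tau x)^2) + lam * Ω tau)) := by
  have hpos : ∀ x, 0 < M0 x + M1 x := fun x => add_pos (hM0 x) (hM1 x)
  have key : ∀ tau y : X → ℝ, G tau y = (1/2) * ∑ x, Me x * (tauhat x - tau x)^2
      + (1/2) * ∑ x, (M0 x + M1 x) * (y x - ystar tau x)^2 := by
    intro tau y
    rw [hG, ← mul_add, ← Finset.sum_add_distrib]
    congr 1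
    refine Finset.sum_congr rfl fun x _ => ?_
    rw [hMe, htauhat, hystar]
    have := weighted_sq_add_weighted_sq (hpos x).ne' (ybar0 x) (ybar1 x - tau x) (y x)
    rw [sub_right_comm (ybar1 x), this, sub_right_comm (ybar1 x)]
  have hmin : ∀ tau : X → ℝ,
      G tau (ystar tau) = (1/2) * ∑ x, Me x * (tauhat x - tau x)^2 := by
    intro tau
    simp [key]
  have hlt : ∀ tau y : X → ℝ, y ≠ ystar tau → G tau (ystar tau) < G tau y := by
    intro tau y hy
    obtain ⟨x, hx⟩ := Function.ne_iff.1 hy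
    have hsum : 0 < ∑ x, (M0 x + M1 x) * (y x - ystar tau x)^2 :=
      Finset.sum_pos' (fun x _ => mul_nonneg (hpos x).le (sq_nonneg _))
        ⟨x, Finset.mem_univ x, mul_pos (hpos x) (sq_pos_of_ne_zero (sub_ne_zero.2 hx))⟩
    rw [hmin, key tau y]
    linarith
  refine ⟨hlt, hmin, fun Ω lam => ?_⟩
  simp only [← hmin]
  refine Real.iInf_prod_eq_of_forall_le (fun p => G p.1 p.2 + lam * Ω p.1) ystar fun tau y => ?_
  rcases eq_or_ne y (ystar tau) with rfl | hy
  · exact le_rfl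
  · exact add_le_add_left (hlt tau y hy).le _
end
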